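/- Let α, β ∈ ℝ and let K_{α,β} be the integral operator on ℝ³ given by (K_{α,β} f)(x) = ⟨x⟩^{−α} ∫_{ℝ³} (4π|x−y|)^{−1} ⟨y⟩^{−β} f(y) dy. If there is a constant C > 0 such that ‖K_{α,β} f‖_{L²(ℝ³)} ≤ C ‖f‖_{L²(ℝ³)} for every nonnegative f ∈ C_0^∞(ℝ³), then α > 1/2. -/

import Mathlib

open MeasureTheory Real

noncomputable section

/-- The Japanese bracket `⟨x⟩ = (1 + |x|²)^{1/2}` on `ℝ³`. -/
def jap (x : EuclideanSpace ℝ (Fin 3)) : ℝ := Real.sqrt (1 + ‖x‖ ^ 2)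

/-- The integral operator `K_{α,β}` on `ℝ³` with kernel `(4π|x-y|)⁻¹ ⟨x⟩^{-α} ⟨y⟩^{-β}`,
i.e. the kernel of `⟨x⟩^{-α} (-Δ)^{-1} ⟨y⟩^{-β}` at spectral parameter `z = 0`. -/
def K (α β : ℝ) (f : EuclideanSpace ℝ (Fin 3) → ℝ) (x : EuclideanSpace ℝ (Fin 3)) : ℝ :=
  jap x ^ (-α) * ∫ y, (4 * π * ‖x - y‖)⁻¹ * jap y ^ (-β) * f y

end

/-- The radial function `‖x‖^{-3/2}` is not square integrable at infinity in `ℝ³`. -/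
theorem eLpNorm_indicator_norm_rpow_eq_top {c : ℝ} (hc : 0 < c) :
    eLpNorm (fun x : EuclideanSpace ℝ (Fin 3) =>
      (Set.Ioi (3 : ℝ)).indicator (fun r => c * r ^ (-(3 / 2) : ℝ)) ‖x‖) 2 volume = ⊤ := by
  by_contra hne
  have hmeas : Measurable ((Set.Ioi (3 : ℝ)).indicator (fun r => c * r ^ (-(3 / 2) : ℝ))) :=
    Measurable.indicator (by fun_prop) measurableSet_Ioi
  have hL : MemLp (fun x : EuclideanSpace ℝ (Fin 3) =>
      (Set.Ioi (3 : ℝ)).indicator (fun r => c * r ^ (-(3 / 2) : ℝ)) ‖x‖) 2 volume :=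
    ⟨(hmeas.comp measurable_norm).aestronglyMeasurable, lt_top_iff_ne_top.2 hne⟩
  have hsq := hL.integrable_sq
  have hrad := (integrable_fun_norm_addHaar (volume : Measure (EuclideanSpace ℝ (Fin 3)))
    (f := fun r => ((Set.Ioi (3 : ℝ)).indicator (fun r => c * r ^ (-(3 / 2) : ℝ)) r) ^ 2)).1 hsq
  have hinv : IntegrableOn (fun r : ℝ => r⁻¹) (Set.Ioi 3) := by
    refine IntegrableOn.congr_fun ((hrad.mono_set (Set.Ioi_subset_Ioi
      (by norm_num : (0 : ℝ) ≤ 3))).const_mul (c ^ 2)⁻¹) (fun r hr => ?_) measurableSet_Ioi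
    have hr0 : (0 : ℝ) < r := lt_trans (by norm_num) hr
    have hpow : (r ^ (-(3 / 2) : ℝ)) ^ 2 = (r ^ 3)⁻¹ := by
      rw [← Real.rpow_natCast, ← Real.rpow_mul hr0.le, ← Real.rpow_natCast, ← Real.rpow_neg hr0.le]
      norm_num
    simp only [finrank_euclideanSpace, Fintype.card_fin, smul_eq_mul, Set.indicator_of_mem hr,
      mul_pow, hpow]
    field_simp
  exact not_integrableOn_Ioi_inv hinv

theorem one_le_jap (x : EuclideanSpace ℝ (Fin 3)) : 1 ≤ jap x :=
  Real.one_le_sqrt.2 (by nlinarith [sq_nonneg ‖x‖])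

theorem jap_le_two_mul_norm {x : EuclideanSpace ℝ (Fin 3)} (hx : 1 ≤ ‖x‖) :
    jap x ≤ 2 * ‖x‖ :=
  Real.sqrt_le_iff.2 ⟨by positivity, by nlinarith⟩

theorem continuous_jap_rpow (s : ℝ) : Continuous fun x => jap x ^ s :=
  Continuous.rpow_const (by unfold jap; fun_prop)
    fun x => Or.inl (zero_lt_one.trans_le (one_le_jap x)).ne'

/-- For a nonnegative `f` supported in the ball of radius `2` and `α ≤ 1/2`, the function
`K α β f` decays no faster than `‖x‖^{-3/2}`. -/
theorem le_K_of_three_lt_norm {α : ℝ} (β : ℝ) (hα : α ≤ 1 / 2)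
    {f : EuclideanSpace ℝ (Fin 3) → ℝ} (hf : Continuous f) (hfc : HasCompactSupport f)
    (hf0 : ∀ x, 0 ≤ f x) (hsupp : ∀ y, f y ≠ 0 → ‖y‖ ≤ 2)
    {x : EuclideanSpace ℝ (Fin 3)} (hx : 3 < ‖x‖) :
    (2 : ℝ) ^ (-(1 / 2) : ℝ) * (8 * π)⁻¹ * (∫ y, jap y ^ (-β) * f y) * ‖x‖ ^ (-(3 / 2) : ℝ)
      ≤ K α β f x := by
  have hx0 : 0 < ‖x‖ := by linarith
  have hg0 (y) : 0 ≤ jap y ^ (-β) * f y :=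
    mul_nonneg (Real.rpow_nonneg (zero_le_one.trans (one_le_jap y)) _) (hf0 y)
  have hgi : Integrable fun y => jap y ^ (-β) * f y :=
    ((continuous_jap_rpow _).mul hf).integrable_of_hasCompactSupport hfc.mul_left
  have hker (y) (hy : f y ≠ 0) :
      (8 * π * ‖x‖)⁻¹ ≤ (4 * π * ‖x - y‖)⁻¹ ∧ (4 * π * ‖x - y‖)⁻¹ ≤ 1 := by
    have hy2 := hsupp y hy
    have hlow := norm_sub_norm_le x y
    have hupp := norm_sub_le x y
    have hπ := Real.pi_gt_three
    refine ⟨inv_anti₀ (by nlinarith) (by nlinarith), inv_le_one_of_one_le₀ (by nlinarith)⟩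
  have hki : Integrable fun y => (4 * π * ‖x - y‖)⁻¹ * jap y ^ (-β) * f y := by
    refine hgi.mono' ?_ (Filter.Eventually.of_forall fun y => ?_)
    · have := (continuous_jap_rpow (-β)).measurable
      have := hf.measurable
      exact Measurable.aestronglyMeasurable (by fun_prop)
    · rw [mul_assoc, Real.norm_of_nonneg (mul_nonneg (by positivity) (hg0 y))]
      by_cases hy : f y = 0
      · simp [hy]
      · exact mul_le_of_le_one_left (hg0 y) (hker y hy).2
  have hint : (8 * π * ‖x‖)⁻¹ * ∫ y, jap y ^ (-β) * f y
      ≤ ∫ y, (4 * π * ‖x - y‖)⁻¹ * jap y ^ (-β) * f y := by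
    rw [← integral_const_mul]
    refine integral_mono (hgi.const_mul _) hki fun y => ?_
    simp only [mul_assoc (4 * π * ‖x - y‖)⁻¹]
    by_cases hy : f y = 0
    · simp [hy]
    · exact mul_le_mul_of_nonneg_right (hker y hy).1 (hg0 y)
  have hjap : (2 * ‖x‖) ^ (-(1 / 2) : ℝ) ≤ jap x ^ (-α) :=
    (Real.rpow_le_rpow_of_nonpos (zero_lt_one.trans_le (one_le_jap x))
      (jap_le_two_mul_norm (by linarith)) (by norm_num)).trans
      (Real.rpow_le_rpow_of_exponent_le (one_le_jap x) (by linarith))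
  have hsplit : ‖x‖ ^ (-(3 / 2) : ℝ) = ‖x‖ ^ (-(1 / 2) : ℝ) * ‖x‖⁻¹ := by
    rw [← Real.rpow_neg_one, ← Real.rpow_add hx0]
    norm_num
  calc _ = (2 * ‖x‖) ^ (-(1 / 2) : ℝ) * ((8 * π * ‖x‖)⁻¹ * ∫ y, jap y ^ (-β) * f y) := by
        rw [hsplit, Real.mul_rpow (by norm_num) hx0.le, mul_inv (8 * π)]
        ring
    _ ≤ _ := mul_le_mul hjap hint
        (mul_nonneg (by positivity) (integral_nonneg hg0))
        (Real.rpow_nonneg (zero_le_one.trans (one_le_jap x)) _)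

/-- If `K_{α,β}` satisfies an `L²(ℝ³)` bound on nonnegative test functions, then `α > 1/2`. -/
theorem alpha_gt_half_of_bounded (α β : ℝ)
    (h : ∃ C > 0, ∀ f : EuclideanSpace ℝ (Fin 3) → ℝ,
      ContDiff ℝ (⊤ : ℕ∞) f → HasCompactSupport f → (∀ x, 0 ≤ f x) →
      eLpNorm (K α β f) 2 volume ≤ ENNReal.ofReal C * eLpNorm f 2 volume) :
    1 / 2 < α := by
  by_contra! hα
  obtain ⟨C, -, hC⟩ := h
  let φ : ContDiffBump (0 : EuclideanSpace ℝ (Fin 3)) := ⟨1, 2, by norm_num, by norm_num⟩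
  have hφ0 (x) : 0 ≤ φ x := φ.nonneg
  have hsupp (y) (hy : φ y ≠ 0) : ‖y‖ ≤ 2 := by
    have hmem : y ∈ Metric.ball 0 φ.rOut := φ.support_eq ▸ Function.mem_support.2 hy
    exact (mem_ball_zero_iff.1 hmem).le
  have hI : 0 < ∫ y, jap y ^ (-β) * φ y := by
    refine ((continuous_jap_rpow _).mul φ.continuous).integral_pos_of_hasCompactSupport_nonneg_nonzero
      φ.hasCompactSupport.mul_left (fun y => ?_) (x := 0) ?_
    · exact mul_nonneg (Real.rpow_nonneg (zero_le_one.trans (one_le_jap y)) _) (hφ0 y)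
    · exact mul_ne_zero (Real.rpow_pos_of_pos (zero_lt_one.trans_le (one_le_jap 0)) _).ne'
        (φ.pos_of_mem_ball (Metric.mem_ball_self φ.rOut_pos)).ne'
  have hc : 0 < (2 : ℝ) ^ (-(1 / 2) : ℝ) * (8 * π)⁻¹ * ∫ y, jap y ^ (-β) * φ y := by positivity
  have hfin : eLpNorm (K α β φ) 2 volume < ⊤ :=
    (hC φ φ.contDiff φ.hasCompactSupport hφ0).trans_lt <| ENNReal.mul_lt_top
      ENNReal.ofReal_lt_top (φ.continuous.memLp_of_hasCompactSupport φ.hasCompactSupport).2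
  refine (eLpNorm_indicator_norm_rpow_eq_top hc).not_lt ((eLpNorm_mono fun x => ?_).trans_lt hfin)
  by_cases hx : 3 < ‖x‖
  · rw [Set.indicator_of_mem (Set.mem_Ioi.2 hx), Real.norm_of_nonneg (by positivity)]
    exact (le_K_of_three_lt_norm β hα φ.continuous φ.hasCompactSupport hφ0 hsupp hx).trans
      (Real.le_norm_self _)
  · simp [Set.indicator_of_notMem (show ‖x‖ ∉ Set.Ioi (3 : ℝ) from hx)]
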